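/- Let c = √2 − 1 and define r : ℝ → ℝ by r(z) = (√(1 + √(1 − 16c²z²)) − 1)/c. Then the Gaussian curvature of the associated surface of revolution at the equator, given by K(0) = −r''(0) / (r(0) · (r'(0)² + 1)²), equals 4(2 − √2), and moreover 4(2 − √2) ≠ 1. -/

import Mathlib

/-- The derivative of the unscaled meridian `√(1 + √(1 − a z²))` inside its domain. -/
theorem hasDerivAt_sqrt_one_add_sqrt {a z : ℝ} (h : 0 < 1 - a * z ^ 2) :
    HasDerivAt (fun x => √(1 + √(1 - a * x ^ 2)))
      (-(a * z) / (2 * √(1 - a * z ^ 2) * √(1 + √(1 - a * z ^ 2)))) z := by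
  have hs : 0 < √(1 - a * z ^ 2) := Real.sqrt_pos.2 h
  have ht : 0 < √(1 + √(1 - a * z ^ 2)) := Real.sqrt_pos.2 (by linarith)
  have h₀ : HasDerivAt (fun x : ℝ => 1 - a * x ^ 2) (-(a * (2 * z))) z := by
    simpa using ((hasDerivAt_pow 2 z).const_mul a).const_sub 1
  convert ((h₀.sqrt h.ne').const_add 1).sqrt (by positivity) using 1
  field_simp

/-- The second derivative at the origin of `√(1 + √(1 − a z²))`. -/
theorem hasDerivAt_deriv_sqrt_one_add_sqrt_zero (a : ℝ) :
    HasDerivAt (deriv fun x => √(1 + √(1 - a * x ^ 2))) (-a / (2 * √2)) 0 := by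
  have hcont : Continuous fun x : ℝ => 1 - a * x ^ 2 := by fun_prop
  have hpos : ∀ᶠ x in nhds (0 : ℝ), 0 < 1 - a * x ^ 2 :=
    hcont.continuousAt.eventually (lt_mem_nhds (by norm_num))
  have hs : HasDerivAt (fun x : ℝ => 1 - a * x ^ 2) 0 0 := by
    simpa using ((hasDerivAt_pow 2 (0 : ℝ)).const_mul a).const_sub 1
  have hsqrt : HasDerivAt (fun x : ℝ => √(1 - a * x ^ 2)) 0 0 := by
    simpa using hs.sqrt (by norm_num)
  have hmeridian : HasDerivAt (fun x : ℝ => √(1 + √(1 - a * x ^ 2))) 0 0 := by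
    simpa using (hsqrt.const_add 1).sqrt (by norm_num)
  have hquot := (((hasDerivAt_id' (0 : ℝ)).const_mul a).fun_neg).fun_div
    ((hsqrt.const_mul 2).fun_mul hmeridian) (by norm_num)
  refine HasDerivAt.congr_of_eventuallyEq ?_
    (hpos.mono fun x hx => (hasDerivAt_sqrt_one_add_sqrt hx).deriv)
  refine hquot.congr_deriv ?_
  norm_num
  field_simp

/-- The Gaussian curvature `K(0) = −r''(0)/(r(0)(r'(0)² + 1)²)` of the
volume-normalised Gambier gong at the equator equals `4(2 − √2)`, which differs
from the average curvature `K̄ = 1`. -/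
theorem gong_equatorial_curvature (c : ℝ) (hc : c = Real.sqrt 2 - 1) (r : ℝ → ℝ)
    (hr : ∀ z, r z = (Real.sqrt (1 + Real.sqrt (1 - 16 * c ^ 2 * z ^ 2)) - 1) / c) :
    -(deriv (deriv r) 0) / (r 0 * ((deriv r 0) ^ 2 + 1) ^ 2)
      = 4 * (2 - Real.sqrt 2) ∧
    4 * (2 - Real.sqrt 2) ≠ 1 := by
  have h2 : √2 ^ 2 = (2 : ℝ) := Real.sq_sqrt (by norm_num)
  have hlt : √2 < (3 / 2 : ℝ) := by
    rw [Real.sqrt_lt' (by norm_num)]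
    norm_num
  have hc₀ : c ≠ 0 := by
    rw [hc]
    exact (sub_pos.2 Real.one_lt_sqrt_two).ne'
  have hderiv : deriv r =
      fun z => deriv (fun x => √(1 + √(1 - 16 * c ^ 2 * x ^ 2))) z / c := by
    funext z
    rw [funext hr, deriv_div_const, deriv_sub_const]
  have hr₀ : r 0 = 1 := by
    rw [hr]
    norm_num
    rw [← hc, div_self hc₀]
  have hr₁ : deriv r 0 = 0 := by
    rw [hderiv]
    simp [(hasDerivAt_sqrt_one_add_sqrt (a := 16 * c ^ 2) (z := 0) (by norm_num)).deriv]
  have hr₂ : deriv (deriv r) 0 = -(16 * c ^ 2) / (2 * √2) / c := by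
    rw [hderiv]
    exact ((hasDerivAt_deriv_sqrt_one_add_sqrt_zero (16 * c ^ 2)).div_const c).deriv
  refine ⟨?_, by linarith⟩
  rw [hr₀, hr₁, hr₂]
  field_simp
  rw [hc]
  nlinarith
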